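/- Fix an integer d ≥ 2. For every z > 0 one has the identity G_{−1}(z)·(G_1(z) − 1/z) − 1 = G_{−1}′(z), and this quantity is strictly positive. In particular, the 2×2 matrix M(z) with first row (G_{−1}(z), −1) and second row (−1, G_1(z) − 1/z) has strictly positive determinant and is invertible for every z > 0. -/

import Mathlib

open MeasureTheory Real Filter

/-- The modified Bessel function of the second kind, defined via its integral
representation `K_ν(z) = ∫_0^∞ exp(−z cosh t) cosh(ν t) dt`. -/
noncomputable def besselK (ν z : ℝ) : ℝ :=
  ∫ t in Set.Ioi (0:ℝ), Real.exp (-z * Real.cosh t) * Real.cosh (ν * t)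

/-- The ratio `G_k(z) = K_{(d+1)/2+k}(z) / K_{(d+1)/2}(z)`. -/
noncomputable def G (d k : ℤ) (z : ℝ) : ℝ :=
  besselK (((d : ℝ) + 1) / 2 + (k : ℝ)) z / besselK (((d : ℝ) + 1) / 2) z

theorem two_mul_cosh_mul_cosh (x y : ℝ) :
    2 * (cosh x * cosh y) = cosh (x + y) + cosh (x - y) := by
  rw [Real.cosh_add, Real.cosh_sub]; ring

theorem two_mul_sinh_mul_sinh (x y : ℝ) :
    2 * (sinh x * sinh y) = cosh (x + y) - cosh (x - y) := by
  rw [Real.cosh_add, Real.cosh_sub]; ring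

/-- For `ν > 1/2`, the ratio `cosh ((ν - 1) t) / cosh (ν t)` is strictly decreasing on `[0, ∞)`. -/
theorem cosh_mul_cosh_lt_of_lt {ν s t : ℝ} (hν : 1 / 2 < ν) (hs : 0 ≤ s) (hst : s < t) :
    cosh ((ν - 1) * t) * cosh (ν * s) < cosh ((ν - 1) * s) * cosh (ν * t) := by
  have h1 := two_mul_cosh_mul_cosh (ν * s) ((ν - 1) * t)
  have h2 := two_mul_cosh_mul_cosh (ν * t) ((ν - 1) * s)
  have hk : 0 < (2 * ν - 1) * (t - s) := mul_pos (by linarith) (by linarith)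
  have hk' : 0 ≤ (2 * ν - 1) * (t + s) := mul_nonneg (by linarith) (by linarith)
  have h3 : cosh (ν * s + (ν - 1) * t) < cosh (ν * t + (ν - 1) * s) := by
    rw [Real.cosh_lt_cosh]
    refine lt_of_lt_of_le ?_ (le_abs_self _)
    rw [abs_lt]
    constructor <;> nlinarith
  have h4 : cosh (ν * s - (ν - 1) * t) < cosh (ν * t - (ν - 1) * s) := by
    rw [Real.cosh_lt_cosh]
    refine lt_of_lt_of_le ?_ (le_abs_self _)
    rw [abs_lt]
    constructor <;> nlinarith
  linarith

theorem sq_div_four_le_cosh {t : ℝ} (ht : 0 ≤ t) : t ^ 2 / 4 ≤ cosh t := by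
  rw [Real.cosh_eq]
  linarith [Real.quadratic_le_exp_of_nonneg ht, Real.exp_pos (-t)]

theorem integrableOn_exp_neg_mul_cosh_mul_exp (μ : ℝ) {z : ℝ} (hz : 0 < z) :
    IntegrableOn (fun t => exp (-z * cosh t) * exp (μ * t)) (Set.Ioi 0) := by
  have hdom : IntegrableOn (fun t : ℝ => exp ((μ + 1) ^ 2 / z) * exp (-1 * t)) (Set.Ioi 0) :=
    (exp_neg_integrableOn_Ioi 0 one_pos).const_mul _
  refine Integrable.mono' hdom (Continuous.aestronglyMeasurable (by fun_prop)) ?_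
  refine (ae_restrict_mem measurableSet_Ioi).mono fun t ht => ?_
  have ht : 0 < t := ht
  rw [Real.norm_of_nonneg (by positivity), ← Real.exp_add, ← Real.exp_add, Real.exp_le_exp]
  have h1 := mul_le_mul_of_nonneg_left (sq_div_four_le_cosh ht.le) hz.le
  have h2 : (μ + 1) ^ 2 / z - (μ + 1) * t + z * (t ^ 2 / 4) =
      (z * t / 2 - (μ + 1)) ^ 2 / z := by
    field_simp
    ring
  have h3 : 0 ≤ (z * t / 2 - (μ + 1)) ^ 2 / z := by positivity
  linarith

theorem integrableOn_besselK (ν : ℝ) {z : ℝ} (hz : 0 < z) :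
    IntegrableOn (fun t => exp (-z * cosh t) * cosh (ν * t)) (Set.Ioi 0) := by
  refine (((integrableOn_exp_neg_mul_cosh_mul_exp ν hz).add
    (integrableOn_exp_neg_mul_cosh_mul_exp (-ν) hz)).div_const 2).congr (ae_of_all _ fun t => ?_)
  simp only [Pi.add_apply, Real.cosh_eq (ν * t), neg_mul]
  ring

theorem integrableOn_exp_neg_mul_cosh_mul_sinh (ν : ℝ) {z : ℝ} (hz : 0 < z) :
    IntegrableOn (fun t => exp (-z * cosh t) * sinh (ν * t)) (Set.Ioi 0) := by
  refine (((integrableOn_exp_neg_mul_cosh_mul_exp ν hz).sub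
    (integrableOn_exp_neg_mul_cosh_mul_exp (-ν) hz)).div_const 2).congr (ae_of_all _ fun t => ?_)
  simp only [Pi.sub_apply, Real.sinh_eq (ν * t), neg_mul]
  ring

theorem integrableOn_fun_sub {f g : ℝ → ℝ} {s : Set ℝ} (hf : IntegrableOn f s)
    (hg : IntegrableOn g s) : IntegrableOn (fun t => f t - g t) s :=
  hf.sub hg

theorem setIntegral_Ioi_pos {f : ℝ → ℝ} {a b : ℝ} (hab : a ≤ b)
    (hf : IntegrableOn f (Set.Ioi a)) (hnonneg : ∀ t, a < t → 0 ≤ f t)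
    (hpos : ∀ t, b < t → 0 < f t) : 0 < ∫ t in Set.Ioi a, f t := by
  rw [setIntegral_pos_iff_support_of_nonneg_ae
    ((ae_restrict_mem measurableSet_Ioi).mono fun t ht => hnonneg t ht) hf]
  have hsub : Set.Ioi b ⊆ Function.support f ∩ Set.Ioi a :=
    fun t ht => ⟨(hpos t ht).ne', lt_of_le_of_lt hab ht⟩
  exact lt_of_lt_of_le (by simp) (measure_mono hsub)

theorem besselK_pos (ν : ℝ) {z : ℝ} (hz : 0 < z) : 0 < besselK ν z :=
  setIntegral_Ioi_pos le_rfl (integrableOn_besselK ν hz)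
    (fun t _ => by positivity) (fun t _ => by positivity)

theorem besselK_le_besselK {μ ν z : ℝ} (hz : 0 < z) (h : |μ| ≤ |ν|) :
    besselK μ z ≤ besselK ν z := by
  refine integral_mono (integrableOn_besselK μ hz) (integrableOn_besselK ν hz) fun t => ?_
  refine mul_le_mul_of_nonneg_left ?_ (exp_pos _).le
  rw [Real.cosh_le_cosh, abs_mul, abs_mul]
  exact mul_le_mul_of_nonneg_right h (abs_nonneg t)

theorem two_mul_cosh_mul_cosh_mul (ν t : ℝ) :
    2 * (cosh t * cosh (ν * t)) = cosh ((ν + 1) * t) + cosh ((ν - 1) * t) := by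
  rw [mul_comm (cosh t), two_mul_cosh_mul_cosh]
  ring_nf

theorem integral_cosh_mul_besselK (ν : ℝ) {z : ℝ} (hz : 0 < z) :
    IntegrableOn (fun t => cosh t * (exp (-z * cosh t) * cosh (ν * t))) (Set.Ioi 0) ∧
    ∫ t in Set.Ioi 0, cosh t * (exp (-z * cosh t) * cosh (ν * t)) =
      (besselK (ν + 1) z + besselK (ν - 1) z) / 2 := by
  have heq : (fun t => cosh t * (exp (-z * cosh t) * cosh (ν * t))) = fun t =>
      (exp (-z * cosh t) * cosh ((ν + 1) * t) + exp (-z * cosh t) * cosh ((ν - 1) * t)) / 2 := by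
    funext t
    linear_combination exp (-z * cosh t) / 2 * two_mul_cosh_mul_cosh_mul ν t
  have h1 := integrableOn_besselK (ν + 1) hz
  have h2 := integrableOn_besselK (ν - 1) hz
  rw [heq]
  refine ⟨(h1.add h2).div_const 2, ?_⟩
  rw [integral_div, integral_add h1 h2]
  rfl

theorem hasDerivAt_besselK (ν : ℝ) {z : ℝ} (hz : 0 < z) :
    HasDerivAt (besselK ν) (-((besselK (ν + 1) z + besselK (ν - 1) z) / 2)) z := by
  have key := hasDerivAt_integral_of_dominated_loc_of_deriv_le
    (μ := volume.restrict (Set.Ioi (0 : ℝ))) (x₀ := z) (s := Set.Ioi (z / 2))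
    (F := fun x t => exp (-x * cosh t) * cosh (ν * t))
    (F' := fun x t => -(cosh t * (exp (-x * cosh t) * cosh (ν * t))))
    (bound := fun t => cosh t * (exp (-(z / 2) * cosh t) * cosh (ν * t)))
    (Ioi_mem_nhds (by linarith))
    (Eventually.of_forall fun x => Continuous.aestronglyMeasurable (by fun_prop))
    (integrableOn_besselK ν hz)
    (Continuous.aestronglyMeasurable (by fun_prop))
    (ae_of_all _ fun t x hx => by
      have hx : z / 2 < x := hx
      rw [norm_neg, Real.norm_of_nonneg (by positivity)]
      have hc := Real.cosh_pos t
      gcongr)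
    (integral_cosh_mul_besselK ν (half_pos hz)).1
    (ae_of_all _ fun t x _ => by
      have h := (((hasDerivAt_id x).neg.mul_const (cosh t)).exp).mul_const (cosh (ν * t))
      refine h.congr_deriv ?_
      simp
      ring)
  refine key.2.congr_deriv ?_
  rw [integral_neg, (integral_cosh_mul_besselK ν hz).2]

theorem besselK_add_one_sub (ν : ℝ) {z : ℝ} (hz : 0 < z) :
    z * (besselK (ν + 1) z - besselK (ν - 1) z) = 2 * ν * besselK ν z := by
  have h0 := integrableOn_besselK ν hz
  have h1 := integrableOn_besselK (ν + 1) hz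
  have h2 := integrableOn_besselK (ν - 1) hz
  have hint := integrableOn_fun_sub (h0.const_mul ν) ((integrableOn_fun_sub h1 h2).const_mul (z / 2))
  have hderiv : ∀ t : ℝ, HasDerivAt (fun t => exp (-z * cosh t) * sinh (ν * t))
      (ν * (exp (-z * cosh t) * cosh (ν * t)) - z / 2 *
        (exp (-z * cosh t) * cosh ((ν + 1) * t) - exp (-z * cosh t) * cosh ((ν - 1) * t))) t := by
    intro t
    have h := (((Real.hasDerivAt_cosh t).const_mul (-z)).exp).mul
      (((hasDerivAt_id t).const_mul ν).sinh)
    refine h.congr_deriv ?_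
    have hs := two_mul_sinh_mul_sinh (ν * t) t
    rw [show ν * t + t = (ν + 1) * t by ring, show ν * t - t = (ν - 1) * t by ring] at hs
    simp only [id, mul_one]
    linear_combination (-z / 2 * exp (-z * cosh t)) * hs
  have hlim := tendsto_zero_of_hasDerivAt_of_integrableOn_Ioi (a := 0) (fun t _ => hderiv t) hint
    (integrableOn_exp_neg_mul_cosh_mul_sinh ν hz)
  have hval := integral_Ioi_of_hasDerivAt_of_tendsto' (a := 0) (fun t _ => hderiv t) hint hlim
  rw [integral_sub (h0.const_mul ν) ((integrableOn_fun_sub h1 h2).const_mul (z / 2)), integral_const_mul,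
    integral_const_mul, integral_sub h1 h2] at hval
  simp only [mul_zero, Real.sinh_zero, sub_zero] at hval
  change ν * besselK ν z - z / 2 * (besselK (ν + 1) z - besselK (ν - 1) z) = 0 at hval
  linarith

/-- A level of the ratio `cosh ((ν - 1) t) / cosh (ν t)` in `(0, 1]` is attained on `[0, ∞)`. -/
theorem exists_cosh_eq_mul_cosh {ν c : ℝ} (hν : 1 ≤ ν) (hc : 0 < c) (hc' : c ≤ 1) :
    ∃ t, 0 ≤ t ∧ cosh ((ν - 1) * t) = c * cosh (ν * t) := by
  have hT : 0 ≤ 1 / c := by positivity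
  have hcont : ContinuousOn (fun t => cosh ((ν - 1) * t) - c * cosh (ν * t))
      (Set.Icc 0 (1 / c)) := by fun_prop
  have hend : cosh ((ν - 1) * (1 / c)) - c * cosh (ν * (1 / c)) ≤ 0 := by
    have h1 : 1 ≤ c * cosh (1 / c) := by
      have := (Real.self_le_sinh_iff.2 hT).trans (Real.sinh_lt_cosh _).le
      rwa [div_le_iff₀' hc] at this
    have h2 : cosh ((ν - 1) * (1 / c)) * cosh (1 / c) ≤ cosh (ν * (1 / c)) := by
      rw [show ν * (1 / c) = (ν - 1) * (1 / c) + 1 / c by ring, Real.cosh_add]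
      have := mul_nonneg (Real.sinh_nonneg_iff.2 (mul_nonneg (sub_nonneg.2 hν) hT))
        (Real.sinh_nonneg_iff.2 hT)
      linarith
    nlinarith [Real.cosh_pos ((ν - 1) * (1 / c))]
  obtain ⟨t, ht, h⟩ := intermediate_value_Icc' hT hcont
    (show (0 : ℝ) ∈ _ from ⟨hend, by simpa using hc'⟩)
  exact ⟨t, ht.1, sub_eq_zero.1 h⟩

/-- Chebyshev's correlation inequality for the decreasing function `cosh ((ν - 1) t) / cosh (ν t)`
and the increasing function `cosh t` under the weight `exp (-z cosh t) cosh (ν t)`. -/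
theorem besselK_mul_add_lt {ν z : ℝ} (hν : 1 ≤ ν) (hz : 0 < z) :
    besselK ν z * (besselK ν z + besselK (ν - 2) z) <
      besselK (ν - 1) z * (besselK (ν + 1) z + besselK (ν - 1) z) := by
  have hD := besselK_pos ν hz
  have hN := besselK_pos (ν - 1) hz
  set c := besselK (ν - 1) z / besselK ν z with hc
  have hcD : c * besselK ν z = besselK (ν - 1) z := div_mul_cancel₀ _ hD.ne'
  have hc1 : c ≤ 1 := by
    rw [hc, div_le_one hD]
    refine besselK_le_besselK hz ?_
    rw [abs_of_nonneg (by linarith), abs_of_nonneg (by linarith)]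
    linarith
  obtain ⟨s, hs, hsc⟩ := exists_cosh_eq_mul_cosh (c := c) hν (div_pos hN hD) hc1
  have hgt : ∀ t, s < t → cosh ((ν - 1) * t) - c * cosh (ν * t) < 0 := fun t ht => by
    have h := cosh_mul_cosh_lt_of_lt (by linarith : 1 / 2 < ν) hs ht
    rw [hsc, mul_right_comm] at h
    linarith [lt_of_mul_lt_mul_right h (Real.cosh_pos _).le]
  have hlt : ∀ t, 0 < t → t < s → 0 < cosh ((ν - 1) * t) - c * cosh (ν * t) := fun t h0 ht => by
    have h := cosh_mul_cosh_lt_of_lt (by linarith : 1 / 2 < ν) h0.le ht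
    rw [hsc, mul_right_comm] at h
    linarith [lt_of_mul_lt_mul_right h (Real.cosh_pos _).le]
  have ha := integrableOn_besselK (ν - 1) hz
  have hb := integrableOn_besselK ν hz
  obtain ⟨ha', hav⟩ := integral_cosh_mul_besselK (ν - 1) hz
  obtain ⟨hb', hbv⟩ := integral_cosh_mul_besselK ν hz
  have hi1 := (integrableOn_fun_sub ha (hb.const_mul c)).const_mul (cosh s)
  have hi2 := integrableOn_fun_sub ha' (hb'.const_mul c)
  have hfac : ∀ t, cosh s * (exp (-z * cosh t) * cosh ((ν - 1) * t) -
        c * (exp (-z * cosh t) * cosh (ν * t))) -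
      (cosh t * (exp (-z * cosh t) * cosh ((ν - 1) * t)) -
        c * (cosh t * (exp (-z * cosh t) * cosh (ν * t)))) =
      exp (-z * cosh t) * ((cosh ((ν - 1) * t) - c * cosh (ν * t)) * (cosh s - cosh t)) :=
    fun t => by ring
  have hpos : ∀ t, s < t →
      0 < exp (-z * cosh t) * ((cosh ((ν - 1) * t) - c * cosh (ν * t)) * (cosh s - cosh t)) :=
    fun t ht => by
      refine mul_pos (exp_pos _) (mul_pos_of_neg_of_neg (hgt t ht) (sub_neg.2 ?_))
      rwa [Real.cosh_lt_cosh, abs_of_nonneg hs, abs_of_nonneg (hs.trans ht.le)]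
  have hint := setIntegral_Ioi_pos hs (integrableOn_fun_sub hi1 hi2)
    (fun t ht => by
      refine le_of_le_of_eq ?_ (hfac t).symm
      rcases lt_trichotomy t s with h | rfl | h
      · refine mul_nonneg (exp_pos _).le (mul_nonneg (hlt t ht h).le (sub_nonneg.2 ?_))
        rw [Real.cosh_le_cosh, abs_of_nonneg hs, abs_of_nonneg ht.le]
        exact h.le
      · simp
      · exact (hpos t h).le)
    (fun t ht => lt_of_lt_of_eq (hpos t ht) (hfac t).symm)
  rw [integral_sub hi1 hi2, integral_const_mul, integral_sub ha (hb.const_mul c),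
    integral_sub ha' (hb'.const_mul c), integral_const_mul, integral_const_mul, hav, hbv] at hint
  change 0 < cosh s * (besselK (ν - 1) z - c * besselK ν z) - _ at hint
  rw [hcD, show ν - 1 + 1 = ν by ring, show ν - 1 - 1 = ν - 2 by ring] at hint
  have hlt' : besselK ν z + besselK (ν - 2) z < c * (besselK (ν + 1) z + besselK (ν - 1) z) := by
    linarith
  calc _ < besselK ν z * (c * (besselK (ν + 1) z + besselK (ν - 1) z)) :=
        mul_lt_mul_of_pos_left hlt' hD
    _ = _ := by rw [← hcD]; ring

theorem hasDerivAt_besselK_div (ν : ℝ) {z : ℝ} (hz : 0 < z) :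
    HasDerivAt (fun x => besselK (ν - 1) x / besselK ν x)
      (besselK (ν - 1) z / besselK ν z * (besselK (ν + 1) z / besselK ν z - 1 / z) - 1) z := by
  have hD := (besselK_pos ν hz).ne'
  refine ((hasDerivAt_besselK (ν - 1) hz).div (hasDerivAt_besselK ν hz) hD).congr_deriv ?_
  have h1 := besselK_add_one_sub (ν - 1) hz
  have h2 := besselK_add_one_sub ν hz
  rw [show ν - 1 + 1 = ν by ring, show ν - 1 - 1 = ν - 2 by ring] at *
  field_simp
  linear_combination besselK ν z * h1 - besselK (ν - 1) z * h2

theorem besselK_div_mul_sub_pos {ν z : ℝ} (hν : 1 ≤ ν) (hz : 0 < z) :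
    0 < besselK (ν - 1) z / besselK ν z * (besselK (ν + 1) z / besselK ν z - 1 / z) - 1 := by
  have hD := besselK_pos ν hz
  have h := besselK_mul_add_lt hν hz
  have h1 := besselK_add_one_sub (ν - 1) hz
  have h2 := besselK_add_one_sub ν hz
  rw [show ν - 1 + 1 = ν by ring, show ν - 1 - 1 = ν - 2 by ring] at h1
  have heq : besselK (ν - 1) z / besselK ν z * (besselK (ν + 1) z / besselK ν z - 1 / z) - 1 =
      (besselK (ν - 1) z * (besselK (ν + 1) z + besselK (ν - 1) z) -
        besselK ν z * (besselK ν z + besselK (ν - 2) z)) / (2 * besselK ν z ^ 2) := by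
    field_simp
    linear_combination besselK (ν - 1) z * h2 - besselK ν z * h1
  rw [heq]
  exact div_pos (sub_pos.2 h) (by positivity)

/-- For every `z > 0`, `G_{−1}(z)(G_1(z) − 1/z) − 1 = G_{−1}′(z) > 0`; in particular
the matrix `M(z) = [[G_{−1}(z), −1], [−1, G_1(z) − 1/z]]` has strictly positive
determinant and is invertible. -/
theorem M_det_pos (d : ℤ) (hd : 2 ≤ d) (z : ℝ) (hz : 0 < z) :
    G d (-1) z * (G d 1 z - 1 / z) - 1 = deriv (G d (-1)) z ∧
    0 < G d (-1) z * (G d 1 z - 1 / z) - 1 ∧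
    0 < (!![G d (-1) z, -1; -1, G d 1 z - 1 / z] : Matrix (Fin 2) (Fin 2) ℝ).det ∧
    IsUnit (!![G d (-1) z, -1; -1, G d 1 z - 1 / z] : Matrix (Fin 2) (Fin 2) ℝ) := by
  have hν : (1 : ℝ) ≤ ((d : ℝ) + 1) / 2 := by
    have : (2 : ℝ) ≤ d := by exact_mod_cast hd
    linarith
  have hG : G d (-1) = fun x => besselK (((d : ℝ) + 1) / 2 - 1) x /
      besselK (((d : ℝ) + 1) / 2) x := by
    funext x
    simp [G, sub_eq_add_neg]
  have hG1 : G d 1 z = besselK (((d : ℝ) + 1) / 2 + 1) z / besselK (((d : ℝ) + 1) / 2) z := by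
    simp [G]
  have hpos : 0 < G d (-1) z * (G d 1 z - 1 / z) - 1 := by
    rw [hG, hG1]
    exact besselK_div_mul_sub_pos hν hz
  have hdet : 0 < (!![G d (-1) z, -1; -1, G d 1 z - 1 / z] : Matrix (Fin 2) (Fin 2) ℝ).det := by
    rw [Matrix.det_fin_two_of]
    linarith
  refine ⟨?_, hpos, hdet, ?_⟩
  · rw [hG, hG1]
    exact (hasDerivAt_besselK_div _ hz).deriv.symm
  · rw [Matrix.isUnit_iff_isUnit_det]
    exact hdet.ne'.isUnit
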